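/- For every integer n > 2, there exists a unique real ζ > 1 for which there exists a sequence ε_1,…,ε_n satisfying the recurrence (★) for all j = 1,…,n−1 together with 0 = ε_n < ε_{n−1} < … < ε_2 < ε_1 = 1. -/

import Mathlib

open Finset

/-- `P_n(t) = ∑_{i=1}^n t^i`. -/
noncomputable def Pn (n : ℕ) (t : ℝ) : ℝ := ∑ i ∈ Finset.Icc 1 n, t ^ i

/-- `P_n'(t) = ∑_{i=1}^n i t^{i-1}`. -/
noncomputable def Pn' (n : ℕ) (t : ℝ) : ℝ := ∑ i ∈ Finset.Icc 1 n, (i : ℝ) * t ^ (i - 1)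

/-- The recurrence (★): for `j = 1, …, n-1`,
`P_n'(1-ε_{j+1}) - P_n'(1-ε_j) = ε_{j+1} P_n'(1-ε_{j+1}) + P_n(1-ε_{j+1}) - j/ζ`. -/
def Recurrence (n : ℕ) (ζ : ℝ) (ε : ℕ → ℝ) : Prop :=
  ∀ j, 1 ≤ j → j ≤ n - 1 →
    Pn' n (1 - ε (j+1)) - Pn' n (1 - ε j)
      = ε (j+1) * Pn' n (1 - ε (j+1)) + Pn n (1 - ε (j+1)) - (j : ℝ) / ζ

/-- `G_n(t) = t P_n'(t) - P_n(t)`, in terms of which (★) reads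
`G_n(1-ε_{j+1}) = P_n'(1-ε_j) - j/ζ`. -/
noncomputable def Gn (n : ℕ) (t : ℝ) : ℝ := t * Pn' n t - Pn n t

lemma Pn_succ (n : ℕ) (t : ℝ) : Pn (n + 1) t = Pn n t + t ^ (n + 1) := by
  simp [Pn, Finset.sum_Icc_succ_top]

lemma Pn'_succ (n : ℕ) (t : ℝ) : Pn' (n + 1) t = Pn' n t + (n + 1) * t ^ n := by
  simp [Pn', Finset.sum_Icc_succ_top]

lemma Pn_zero (t : ℝ) : Pn 0 t = 0 := by simp [Pn]

lemma Pn'_zero (t : ℝ) : Pn' 0 t = 0 := by simp [Pn']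

lemma Gn_zero (t : ℝ) : Gn 0 t = 0 := by simp [Gn, Pn_zero, Pn'_zero]

lemma Gn_succ (n : ℕ) (t : ℝ) : Gn (n + 1) t = Gn n t + n * t ^ (n + 1) := by
  rw [Gn, Gn, Pn_succ, Pn'_succ]; ring

lemma continuous_Pn' (n : ℕ) : Continuous (Pn' n) := by
  unfold Pn'; fun_prop

lemma continuous_Gn (n : ℕ) : Continuous (Gn n) := by
  unfold Gn Pn' Pn; fun_prop

lemma Pn'_mono (n : ℕ) {x y : ℝ} (hx : 0 ≤ x) (hxy : x ≤ y) : Pn' n x ≤ Pn' n y := by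
  unfold Pn'; gcongr

lemma Pn'_succ_at_zero (n : ℕ) : Pn' (n + 1) 0 = 1 := by
  induction n with
  | zero => simp [Pn'_succ, Pn'_zero]
  | succ n ih => rw [Pn'_succ, ih]; simp

lemma Pn'_at_one (n : ℕ) : Pn' n 1 = n * (n + 1) / 2 := by
  induction n with
  | zero => simp [Pn'_zero]
  | succ n ih => rw [Pn'_succ, ih]; push_cast; ring

lemma Gn_at_zero (n : ℕ) : Gn n 0 = 0 := by
  induction n with
  | zero => exact Gn_zero 0
  | succ n ih => rw [Gn_succ, ih]; simp

lemma Gn_at_one (n : ℕ) : Gn n 1 = n * (n - 1) / 2 := by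
  induction n with
  | zero => simp [Gn_zero]
  | succ n ih => rw [Gn_succ, ih]; push_cast; ring

lemma one_le_Pn' {n : ℕ} (hn : 1 ≤ n) {x : ℝ} (hx : 0 ≤ x) : 1 ≤ Pn' n x := by
  obtain ⟨m, rfl⟩ := Nat.exists_eq_add_of_le' hn
  simpa [Pn'_succ_at_zero] using Pn'_mono (m + 1) le_rfl hx

lemma Gn_strictMonoOn {n : ℕ} (hn : 2 ≤ n) : StrictMonoOn (Gn n) (Set.Ici 0) := by
  intro x hx y hy hxy
  have hx : 0 ≤ x := hx
  induction n, hn using Nat.le_induction with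
  | base =>
    simp only [Gn_succ, Gn_zero]
    norm_num
    gcongr
  | succ n hn ih =>
    rw [Gn_succ, Gn_succ]
    have : (n : ℝ) * x ^ (n + 1) ≤ n * y ^ (n + 1) := by gcongr
    linarith

lemma Gn_lt_iff {n : ℕ} (hn : 2 ≤ n) {x y : ℝ} (hx : 0 ≤ x) (hy : 0 ≤ y) :
    Gn n x < Gn n y ↔ x < y :=
  (Gn_strictMonoOn hn).lt_iff_lt hx hy

lemma Gn_le_iff {n : ℕ} (hn : 2 ≤ n) {x y : ℝ} (hx : 0 ≤ x) (hy : 0 ≤ y) :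
    Gn n x ≤ Gn n y ↔ x ≤ y :=
  (Gn_strictMonoOn hn).le_iff_le hx hy

lemma sq_le_Gn {n : ℕ} (hn : 2 ≤ n) {x : ℝ} (hx : 0 ≤ x) : x ^ 2 ≤ Gn n x := by
  induction n, hn using Nat.le_induction with
  | base => simp [Gn_succ, Gn_zero]
  | succ n hn ih =>
    rw [Gn_succ]
    have : 0 ≤ (n : ℝ) * x ^ (n + 1) := by positivity
    linarith

/-- A continuous inverse of `G_n` on the nonnegative reals, extended by `0`. -/
lemma exists_continuous_inverse_Gn {n : ℕ} (hn : 2 ≤ n) :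
    ∃ g : ℝ → ℝ, Continuous g ∧ (∀ y, 0 ≤ g y) ∧ ∀ y, Gn n (g y) = max y 0 := by
  let H : ℝ → ℝ := fun y => Gn n (max y 0) + min y 0
  have hH0 : ∀ y, 0 ≤ y → H y = Gn n y := fun y hy => by simp [H, hy]
  have hHneg : ∀ y, y ≤ 0 → H y = y := fun y hy => by simp [H, hy, Gn_at_zero]
  have hcont : Continuous H :=
    ((continuous_Gn n).comp (continuous_id.max continuous_const)).add
      (continuous_id.min continuous_const)
  have hmono : StrictMono H := by
    intro x y hxy
    have h1 : Gn n (max x 0) ≤ Gn n (max y 0) :=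
      (Gn_le_iff hn (le_max_right _ _) (le_max_right _ _)).2 (max_le_max_right _ hxy.le)
    have h2 : min x 0 ≤ min y 0 := min_le_min_right _ hxy.le
    rcases lt_or_ge x 0 with hx | hx
    · have : min x 0 < min y 0 := by
        rw [min_eq_left hx.le]; exact lt_min hxy hx
      exact add_lt_add_of_le_of_lt h1 this
    · rw [hH0 x hx, hH0 y (hx.trans hxy.le)]
      exact (Gn_lt_iff hn hx (hx.trans hxy.le)).2 hxy
  have htop : Filter.Tendsto H Filter.atTop Filter.atTop := by
    refine Filter.tendsto_atTop_mono' _ ?_ (Filter.tendsto_pow_atTop (two_ne_zero))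
    filter_upwards [Filter.eventually_ge_atTop 0] with y hy
    rw [hH0 y hy]
    exact sq_le_Gn hn hy
  have hbot : Filter.Tendsto H Filter.atBot Filter.atBot := by
    refine Filter.tendsto_id.congr' ?_
    filter_upwards [Filter.eventually_le_atBot 0] with y hy
    exact (hHneg y hy).symm
  let e := hmono.orderIsoOfSurjective H (hcont.surjective htop hbot)
  have hnn : ∀ y, 0 ≤ e.symm (max y 0) := by
    intro y
    rw [e.le_symm_apply]
    change H 0 ≤ _
    rw [hHneg 0 le_rfl]
    exact le_max_right _ _
  refine ⟨fun y => e.symm (max y 0),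
    e.symm.continuous.comp (continuous_id.max continuous_const), hnn, fun y => ?_⟩
  rw [← hH0 _ (hnn y)]
  exact e.apply_symm_apply _

lemma geom_sum_mul_one_sub (m : ℕ) (x : ℝ) :
    (1 - x) * ∑ i ∈ range m, x ^ i = 1 - x ^ m := by
  rw [mul_comm]; exact geom_sum_mul_neg x m

lemma Pn'_sub_Gn (m : ℕ) (x : ℝ) :
    Pn' (m + 1) x - Gn (m + 1) x
      = 1 + x * (2 * ∑ i ∈ range m, x ^ i - m * x ^ m) := by
  induction m with
  | zero => simp [Pn'_succ, Pn'_zero, Gn_succ, Gn_zero]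
  | succ m ih =>
    rw [Pn'_succ, Gn_succ, Finset.sum_range_succ]
    push_cast
    linear_combination ih

lemma Gn_mul_one_sub (m : ℕ) (x : ℝ) :
    Gn (m + 1) x * (1 - x) = x ^ 2 * (∑ i ∈ range m, x ^ i - m * x ^ m) := by
  induction m with
  | zero => simp [Gn_succ, Gn_zero]
  | succ m ih =>
    rw [Gn_succ, Finset.sum_range_succ]
    push_cast
    linear_combination ih

lemma mul_pow_le_geom_sum (m : ℕ) {x : ℝ} (hx : 0 ≤ x) (hx1 : x ≤ 1) :
    m * x ^ m ≤ ∑ i ∈ range m, x ^ i := by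
  have : ∑ i ∈ range m, x ^ m ≤ ∑ i ∈ range m, x ^ i :=
    sum_le_sum fun i hi => pow_le_pow_of_le_one hx hx1 (mem_range.1 hi).le
  simpa using this

lemma geom_sum_le (m : ℕ) {x : ℝ} (hx : 0 ≤ x) (hx1 : x ≤ 1) :
    ∑ i ∈ range m, x ^ i ≤ m := by
  have : ∑ i ∈ range m, x ^ i ≤ ∑ i ∈ range m, (1 : ℝ) :=
    sum_le_sum fun i _ => pow_le_one₀ hx hx1
  simpa using this

lemma succ_mul_pow_le (m : ℕ) {x : ℝ} (hx : 0 ≤ x) (hx1 : x ≤ 1) :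
    (m + 1) * x ^ m ≤ 1 + m * x ^ (m + 1) := by
  induction m with
  | zero => simp
  | succ m ih =>
    have h1 := mul_le_mul_of_nonneg_left ih hx
    have h2 := mul_nonneg (sub_nonneg.2 hx1) (sub_nonneg.2 (pow_le_one₀ (n := m + 1) hx hx1))
    push_cast
    ring_nf at h1 h2 ⊢
    linarith

/-- The upper trapezoidal bound for a geometric sum. -/
lemma two_mul_geom_sum_le (m : ℕ) (hm : 1 ≤ m) {x : ℝ} (hx : 0 ≤ x) (hx1 : x ≤ 1) :
    2 * ∑ i ∈ range m, x ^ i ≤ (m + 1) + (m - 1) * x ^ m := by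
  induction m, hm using Nat.le_induction with
  | base => norm_num
  | succ m hm ih =>
    have := succ_mul_pow_le m hx hx1
    rw [Finset.sum_range_succ]
    push_cast
    linarith

/-- The AM-GM bound for a geometric sum. -/
lemma sq_mul_pow_le_geom_sum_sq (m : ℕ) {x : ℝ} (hx : 0 ≤ x) (hx1 : x ≤ 1) :
    (m : ℝ) ^ 2 * x ^ m ≤ (∑ i ∈ range m, x ^ i) ^ 2 := by
  obtain ⟨y, hy, rfl⟩ : ∃ y : ℝ, 0 ≤ y ∧ x = y ^ 2 :=
    ⟨√x, Real.sqrt_nonneg x, (Real.sq_sqrt hx).symm⟩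
  have hy1 : y ≤ 1 := by nlinarith
  have hrefl := Finset.sum_range_reflect (fun i => (y ^ 2) ^ i) m
  have key : ∑ i ∈ range m, 2 * y ^ m
      ≤ ∑ i ∈ range m, ((y ^ 2) ^ i + (y ^ 2) ^ (m - 1 - i)) := by
    refine sum_le_sum fun i hi => ?_
    have hi := mem_range.1 hi
    have h1 : y ^ m ≤ y ^ i * y ^ (m - 1 - i) := by
      rw [← pow_add]
      exact pow_le_pow_of_le_one hy hy1 (by omega)
    rw [pow_right_comm y 2, pow_right_comm y 2]
    nlinarith [sq_nonneg (y ^ i - y ^ (m - 1 - i))]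
  rw [sum_add_distrib, hrefl] at key
  simp only [sum_const, card_range, nsmul_eq_mul] at key
  have h2 : m * y ^ m ≤ ∑ i ∈ range m, (y ^ 2) ^ i := by linarith
  calc (m : ℝ) ^ 2 * (y ^ 2) ^ m = (m * y ^ m) ^ 2 := by ring
    _ ≤ _ := by gcongr

lemma two_mul_Gn_lt {m : ℕ} (hm : 1 ≤ m) {x : ℝ} (hx : 0 < x) (hx1 : x < 1) :
    2 * Gn (m + 1) x < (Pn' (m + 1) x - Gn (m + 1) x) * (Pn' (m + 1) x - Gn (m + 1) x - 1) := by
  rw [Pn'_sub_Gn]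
  have hG := Gn_mul_one_sub m x
  have hA := geom_sum_mul_one_sub m x
  have h1 := mul_pow_le_geom_sum m hx.le hx1.le
  have h2 := geom_sum_le m hx.le hx1.le
  have h3 := two_mul_geom_sum_le m hm hx.le hx1.le
  have h4 := sq_mul_pow_le_geom_sum_sq m hx.le hx1.le
  have hm0 : (0 : ℝ) < m := by exact_mod_cast hm
  have hq0 : 0 < x ^ m := by positivity
  have hq1 : x ^ m < 1 := pow_lt_one₀ hx.le hx1 (by omega)
  set A := ∑ i ∈ range m, x ^ i
  set q := x ^ m
  set G := Gn (m + 1) x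
  have hGq : G * (1 - q) = x ^ 2 * (A * (A - m * q)) := by
    rw [← hA]; linear_combination A * hG
  have hApos : 0 < A := lt_of_lt_of_le (by positivity) h1
  have hu : 0 < x * (2 * A - m * q) := mul_pos hx (by linarith)
  refine lt_of_mul_lt_mul_right ?_ (sub_pos.2 hq1).le
  rcases le_or_gt q (1 / 2) with hq | hq
  · have e1 : 2 * G * (1 - q) ≤ (x * (2 * A - m * q)) ^ 2 * (1 / 2) := by
      have : 0 ≤ (x * (m * q)) ^ 2 := sq_nonneg _
      nlinarith
    have e2 : (x * (2 * A - m * q)) ^ 2 * (1 / 2) ≤ (x * (2 * A - m * q)) ^ 2 * (1 - q) := by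
      gcongr; linarith
    have e3 : 0 < x * (2 * A - m * q) * (1 - q) := mul_pos hu (sub_pos.2 hq1)
    nlinarith
  · obtain ⟨s, hs⟩ : ∃ s, A = m * s := ⟨A / m, by field_simp⟩
    rw [hs] at h1 h2 h4 hApos
    have s0 : q ≤ s := le_of_mul_le_mul_left h1 hm0
    have s1 : s ≤ 1 := le_of_mul_le_mul_left (by linarith) hm0
    have s2 : q ≤ s ^ 2 := by
      rw [mul_pow] at h4
      exact le_of_mul_le_mul_left h4 (by positivity)
    have s3 : s ≤ (2 * s - q) ^ 2 := by
      have a1 : (2 * s - s ^ 2) ^ 2 ≤ (2 * s - q) ^ 2 := by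
        apply pow_le_pow_left₀ <;> nlinarith
      have a2 : 0 ≤ (1 - s) * (3 * s - 1 - s ^ 2) :=
        mul_nonneg (by linarith) (by nlinarith)
      have a3 := mul_nonneg (show 0 ≤ s by linarith) a2
      nlinarith
    have s4 : s * x < 2 * s - q := by nlinarith
    have e1 : 2 * G * (1 - q) ≤ x ^ 2 * A * (m + 1) * (1 - q) := by
      have : 2 * (A - m * q) ≤ (m + 1) * (1 - q) := by linarith
      have := mul_le_mul_of_nonneg_left this (show 0 ≤ x ^ 2 * A by rw [hs]; positivity)
      linarith
    refine e1.trans_lt (mul_lt_mul_of_pos_right ?_ (sub_pos.2 hq1))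
    rw [hs]
    have b1 := mul_le_mul_of_nonneg_left s3 (show 0 ≤ x ^ 2 * (m : ℝ) ^ 2 by positivity)
    have b2 := mul_lt_mul_of_pos_left s4 (show 0 < x * (m : ℝ) by positivity)
    linarith

lemma lt_Pn'_of_le_Gn {n j : ℕ} (hj : 2 ≤ j) (hjn : j < n) {x : ℝ} (hx : 0 ≤ x)
    (h : (j : ℝ) * (j - 1) / 2 ≤ Gn n x) : (j : ℝ) * (j + 1) / 2 < Pn' n x := by
  have hj' : (2 : ℝ) ≤ j := by exact_mod_cast hj
  have hjn' : (j : ℝ) < n := by exact_mod_cast hjn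
  rcases le_or_gt 1 x with h1 | h1
  · have := Pn'_mono n zero_le_one h1
    rw [Pn'_at_one] at this
    nlinarith
  · obtain ⟨m, rfl⟩ : ∃ m, n = m + 1 := ⟨n - 1, by omega⟩
    have hx0 : 0 < x := by
      rcases hx.eq_or_lt with rfl | hx
      · rw [Gn_at_zero] at h; nlinarith
      · exact hx
    have key := two_mul_Gn_lt (show 1 ≤ m by omega) hx0 h1
    have hD : 1 ≤ Pn' (m + 1) x - Gn (m + 1) x := by
      rw [Pn'_sub_Gn]
      have := mul_pow_le_geom_sum m hx h1.le
      have h0 : 0 ≤ ∑ i ∈ range m, x ^ i := sum_nonneg fun i _ => pow_nonneg hx i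
      have := mul_nonneg hx (show 0 ≤ 2 * ∑ i ∈ range m, x ^ i - m * x ^ m by linarith)
      linarith
    have : (j : ℝ) < Pn' (m + 1) x - Gn (m + 1) x := by
      by_contra! hc
      nlinarith
    linarith

lemma recurrence_iff {n : ℕ} {ζ : ℝ} {ε : ℕ → ℝ} :
    Recurrence n ζ ε ↔ ∀ j, 1 ≤ j → j ≤ n - 1 →
      Gn n (1 - ε (j + 1)) = Pn' n (1 - ε j) - j / ζ := by
  refine forall_congr' fun j => imp_congr_right fun _ => imp_congr_right fun _ => ?_
  rw [Gn]
  constructor <;> intro h <;> linarith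

lemma le_one_of_decreasing {n : ℕ} {ε : ℕ → ℝ} (h1 : ε 1 = 1)
    (hdec : ∀ j, 1 ≤ j → j < n → ε (j + 1) < ε j) {j : ℕ} (hj : 1 ≤ j) (hjn : j ≤ n) :
    ε j ≤ 1 := by
  induction j, hj using Nat.le_induction with
  | base => exact h1.le
  | succ j hj ih => exact (hdec j hj hjn).le.trans (ih (by omega))

lemma not_lt_of_recurrence {n : ℕ} (hn : 2 ≤ n) {ζ ξ : ℝ} (hζ : 0 < ζ) {ε δ : ℕ → ℝ}
    (hε : Recurrence n ζ ε) (hε1 : ε 1 = 1) (hεn : ε n = 0)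
    (hεd : ∀ j, 1 ≤ j → j < n → ε (j + 1) < ε j)
    (hδ : Recurrence n ξ δ) (hδ1 : δ 1 = 1) (hδn : δ n = 0)
    (hδd : ∀ j, 1 ≤ j → j < n → δ (j + 1) < δ j) : ¬ ζ < ξ := by
  intro hlt
  rw [recurrence_iff] at hε hδ
  have step : ∀ j, 1 ≤ j → j < n → δ j ≤ ε j → δ (j + 1) < ε (j + 1) := by
    intro j hj hjn h
    have e1 := le_one_of_decreasing hε1 hεd hj hjn.le
    have e2 := le_one_of_decreasing hε1 hεd (j := j + 1) (by omega) hjn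
    have d2 := le_one_of_decreasing hδ1 hδd (j := j + 1) (by omega) hjn
    have hP := Pn'_mono n (sub_nonneg.2 e1) (sub_le_sub_left h 1)
    have hj0 : (0 : ℝ) < j := by exact_mod_cast hj
    have hdiv : (j : ℝ) / ξ < j / ζ := div_lt_div_of_pos_left hj0 hζ hlt
    have : Gn n (1 - ε (j + 1)) < Gn n (1 - δ (j + 1)) := by
      rw [hε j hj (by omega), hδ j hj (by omega)]; linarith
    rw [Gn_lt_iff hn (sub_nonneg.2 e2) (sub_nonneg.2 d2)] at this
    linarith
  have weak : ∀ j, 1 ≤ j → j ≤ n → δ j ≤ ε j := by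
    intro j hj
    induction j, hj using Nat.le_induction with
    | base => intro; rw [hδ1, hε1]
    | succ j hj ih => exact fun h => (step j hj h (ih (by omega))).le
  have := step (n - 1) (by omega) (by omega) (weak _ (by omega) (by omega))
  rw [Nat.sub_add_cancel (by omega), hδn, hεn] at this
  exact lt_irrefl _ this

/-- Solve the recurrence forward from `0` with parameter `l = 1/ζ`, given an inverse `g` of
`G_n`. -/
noncomputable def iter (n : ℕ) (g : ℝ → ℝ) (l : ℝ) : ℕ → ℝ
  | 0 => 0
  | k + 1 => g (Pn' n (iter n g l k) - (k + 1) * l)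

lemma continuous_iter {n : ℕ} {g : ℝ → ℝ} (hg : Continuous g) (k : ℕ) :
    Continuous fun l => iter n g l k := by
  induction k with
  | zero => exact continuous_const
  | succ k ih =>
    exact hg.comp (((continuous_Pn' n).comp ih).sub (continuous_const.mul continuous_id))

section Iter

variable {n : ℕ} {g : ℝ → ℝ}

lemma iter_nonneg (hg0 : ∀ y, 0 ≤ g y) (l : ℝ) (k : ℕ) : 0 ≤ iter n g l k := by
  cases k with
  | zero => exact le_rfl
  | succ k => exact hg0 _

lemma Gn_iter_succ (hG : ∀ y, Gn n (g y) = max y 0) (l : ℝ) (k : ℕ) :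
    Gn n (iter n g l (k + 1)) = max (Pn' n (iter n g l k) - (k + 1) * l) 0 :=
  hG _

lemma inverse_Gn_eq_zero (hn : 2 ≤ n) (hg0 : ∀ y, 0 ≤ g y) (hG : ∀ y, Gn n (g y) = max y 0)
    {y : ℝ} (hy : y ≤ 0) : g y = 0 := by
  refine (Gn_strictMonoOn hn).injOn (hg0 y) (Set.mem_Ici.2 le_rfl) ?_
  rw [hG, Gn_at_zero, max_eq_right hy]

/-- Once the iteration has been truncated at `0`, it stays at `0`. -/
lemma iter_eq_zero_of_le (hn : 2 ≤ n) (hg0 : ∀ y, 0 ≤ g y)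
    (hG : ∀ y, Gn n (g y) = max y 0) {l : ℝ} (hl : 0 ≤ l) {k : ℕ}
    (h : Pn' n (iter n g l k) - (k + 1) * l ≤ 0) {i : ℕ} (hi : k + 1 ≤ i) :
    iter n g l i = 0 := by
  have hk : 1 ≤ (k + 1) * l := by
    have := one_le_Pn' (n := n) (by omega) (iter_nonneg (n := n) hg0 l k)
    linarith
  obtain ⟨m, rfl⟩ : ∃ m, n = m + 1 := ⟨n - 1, by omega⟩
  induction i, hi using Nat.le_induction with
  | base => exact inverse_Gn_eq_zero hn hg0 hG h
  | succ i hi ih =>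
    refine inverse_Gn_eq_zero hn hg0 hG ?_
    rw [ih, Pn'_succ_at_zero]
    have : ((k : ℝ) + 1) * l ≤ (i + 1) * l := by
      gcongr
      omega
    linarith

lemma one_lt_iter_zero (hn : 2 < n) (hg0 : ∀ y, 0 ≤ g y)
    (hG : ∀ y, Gn n (g y) = max y 0) : 1 < iter n g 0 (n - 1) := by
  have hrec : ∀ k, Gn n (iter n g 0 (k + 1)) = Pn' n (iter n g 0 k) := by
    intro k
    have := one_le_Pn' (n := n) (by omega) (iter_nonneg (n := n) hg0 0 k)
    rw [Gn_iter_succ hG, mul_zero, sub_zero, max_eq_left (by linarith)]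
  have hweak : ∀ k, 1 ≤ k → k < n →
      ((k + 1 : ℕ) : ℝ) * ((k + 1 : ℕ) - 1) / 2 ≤ Gn n (iter n g 0 k) := by
    intro k hk
    induction k, hk using Nat.le_induction with
    | base =>
      intro _
      have := one_le_Pn' (n := n) (by omega) (iter_nonneg (n := n) hg0 0 0)
      rw [hrec 0]
      norm_num
      exact this
    | succ k hk ih =>
      intro hkn
      have := lt_Pn'_of_le_Gn (by omega) hkn (iter_nonneg hg0 0 k) (ih (by omega))
      rw [hrec k]
      refine le_trans (le_of_eq ?_) this.le
      push_cast; ring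
  obtain ⟨m, rfl⟩ : ∃ m, n = m + 2 := ⟨n - 2, by omega⟩
  have := lt_Pn'_of_le_Gn (n := m + 2) (j := m + 1) (by omega) (by omega) (iter_nonneg hg0 0 m)
    (hweak m (by omega) (by omega))
  rw [← hrec m] at this
  change 1 < iter (m + 2) g 0 (m + 1)
  rw [← Gn_lt_iff hn.le zero_le_one (iter_nonneg hg0 _ _), Gn_at_one]
  refine lt_of_eq_of_lt ?_ this
  push_cast; ring

end Iter

lemma exists_recurrence_solution {n : ℕ} (hn : 2 < n) :
    ∃ ζ : ℝ, 1 < ζ ∧ ∃ ε : ℕ → ℝ, Recurrence n ζ ε ∧ ε 1 = 1 ∧ ε n = 0 ∧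
      (∀ j, 1 ≤ j → j < n → ε (j + 1) < ε j) := by
  obtain ⟨g, hgc, hg0, hG⟩ := exists_continuous_inverse_Gn hn.le
  have hP0 : Pn' n 0 = 1 := by
    obtain ⟨m, rfl⟩ : ∃ m, n = m + 1 := ⟨n - 1, by omega⟩
    exact Pn'_succ_at_zero m
  have htop := one_lt_iter_zero hn hg0 hG
  have hbot : iter n g 1 (n - 1) = 0 := by
    refine iter_eq_zero_of_le hn.le hg0 hG zero_le_one (k := 0) ?_ (by omega)
    simp [iter, hP0]
  obtain ⟨l, ⟨hl0, hl1⟩, hl⟩ : ∃ l ∈ Set.Ioo (0 : ℝ) 1, iter n g l (n - 1) = 1 := by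
    refine intermediate_value_Ioo' zero_le_one (continuous_iter hgc (n - 1)).continuousOn ?_
    simp only [hbot]
    exact ⟨zero_lt_one, htop⟩
  set x := iter n g l with hx
  have hxnn : ∀ k, 0 ≤ x k := iter_nonneg hg0 l
  have hrec : ∀ k, k + 1 < n → Gn n (x (k + 1)) = Pn' n (x k) - (k + 1) * l := by
    intro k hk
    rw [hx, Gn_iter_succ hG, max_eq_left]
    by_contra! hc
    have := iter_eq_zero_of_le hn.le hg0 hG hl0.le hc.le (show k + 1 ≤ n - 1 by omega)
    linarith
  have hstep : ∀ k, k + 2 < n → x (k + 1) < x (k + 2) → x k < x (k + 1) := by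
    intro k hk h
    by_contra! hc
    have h1 := (Gn_lt_iff hn.le (hxnn _) (hxnn _)).2 h
    rw [hrec k (by omega), hrec (k + 1) hk] at h1
    have := Pn'_mono n (hxnn _) hc
    push_cast at h1
    linarith
  have hlast : x (n - 2) < x (n - 1) := by
    by_contra! hc
    have hr := hrec (n - 2) (by omega)
    rw [show n - 2 + 1 = n - 1 by omega, hl, Gn_at_one] at hr
    have := Pn'_mono n (hxnn _) hc
    rw [hl, Pn'_at_one] at this
    have hc2 : ((n - 2 : ℕ) : ℝ) = n - 2 := by
      rw [Nat.cast_sub hn.le]; norm_num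
    rw [hc2] at hr
    have hn' : (2 : ℝ) < n := by exact_mod_cast hn
    nlinarith
  have hinc : ∀ k, k ≤ n - 2 → x k < x (k + 1) := by
    intro k hk
    induction hk using Nat.decreasingInduction with
    | self => rwa [show n - 2 + 1 = n - 1 by omega]
    | of_succ k hk ih => exact hstep k (by omega) ih
  refine ⟨l⁻¹, (one_lt_inv₀ hl0).2 hl1, fun j => 1 - x (j - 1), ?_, ?_, ?_, ?_⟩
  · rw [recurrence_iff]
    intro j hj hjn
    obtain ⟨k, rfl⟩ := Nat.exists_eq_add_of_le' hj
    have := hrec k (by omega)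
    simpa using this
  · simp [hx, iter]
  · simp [hl]
  · intro j hj hjn
    obtain ⟨k, rfl⟩ := Nat.exists_eq_add_of_le' hj
    have := hinc k (by omega)
    simpa using this

/-- For every integer `n > 2` there is a unique `ζ > 1` admitting a
solution `ε_1, …, ε_n` of the recurrence (★) with `0 = ε_n < ε_{n-1} < … < ε_2 < ε_1 = 1`. -/
theorem stmt_3 (n : ℕ) (hn : 2 < n) :
    ∃! ζ : ℝ, 1 < ζ ∧ ∃ ε : ℕ → ℝ,
      Recurrence n ζ ε ∧ ε 1 = 1 ∧ ε n = 0 ∧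
      (∀ j, 1 ≤ j → j < n → ε (j+1) < ε j) := by
  obtain ⟨ζ, hζ, ε, h, h1, hn0, hd⟩ := exists_recurrence_solution hn
  refine ⟨ζ, ⟨hζ, ε, h, h1, hn0, hd⟩, ?_⟩
  rintro ξ ⟨hξ, δ, h', h1', hn0', hd'⟩
  exact le_antisymm
    (not_lt.1 (not_lt_of_recurrence hn.le (by linarith) h h1 hn0 hd h' h1' hn0' hd'))
    (not_lt.1 (not_lt_of_recurrence hn.le (by linarith) h' h1' hn0' hd' h h1 hn0 hd))
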